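/- arXiv:2204.08439 — 2 statements merged into one kernel-verified Lean document; each statement's English description precedes it below -/
import Mathlib

section
/- The variance is monotone under a-majorization: if p and q are supported-below probability distributions on ℤ with finite second moments (Σ_n n²·p(n) < ∞ and Σ_n n²·q(n) < ∞) and p ≻_a q, then Var(p) ≥ Var(q). Moreover, writing w := p*q̃ (which is then a probability distribution on ℤ), one has μ_p = μ_w + μ_q and Var(p) = Var(w) + Var(q). -/
/-- Convolution of two sequences on `ℤ`: `(a*b)(n) = ∑_{k∈ℤ} a(k)·b(n−k)`.
For supported-below sequences this `tsum` has finitely many nonzero terms. -/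
noncomputable def conv (a b : ℤ → ℝ) : ℤ → ℝ := fun n => ∑' k : ℤ, a k * b (n - k)

/-- A sequence is supported below if it vanishes for all sufficiently negative indices. -/
def SuppBelow (a : ℤ → ℝ) : Prop := ∃ N : ℤ, ∀ n : ℤ, n < N → a n = 0

/-- A probability distribution on `ℤ`: nonnegative with total sum 1. -/
def IsProbDist (p : ℤ → ℝ) : Prop := (∀ n : ℤ, 0 ≤ p n) ∧ HasSum p 1

/-- `qt` is the reciprocal sequence `q̃` of `q`, relative to `nstar = n_*(q)`,
the least index where `q` is positive: `q̃` vanishes below `−n_*(q)` and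
`(q̃*q)(n) = δ_{n,0}` for all `n`. -/
def IsRecip (q qt : ℤ → ℝ) (nstar : ℤ) : Prop :=
  IsLeast {n : ℤ | 0 < q n} nstar ∧ (∀ n : ℤ, n < -nstar → qt n = 0) ∧
  (∀ n : ℤ, conv qt q n = if n = 0 then (1 : ℝ) else 0)

/-- The generalized Poisson sequence `P_λ : ℤ → ℝ`,
`P_λ(n) = e^{−λ}·λ^n/n!` for `n ≥ 0` and `P_λ(n) = 0` for `n < 0`. -/
noncomputable def poisson (lam : ℝ) : ℤ → ℝ :=
  fun n => if 0 ≤ n then Real.exp (-lam) * lam ^ n.toNat / (Nat.factorial n.toNat : ℝ) else 0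

/-- Mean `μ_p = ∑_n n·p(n)` of a distribution on `ℤ`. -/
noncomputable def mean (p : ℤ → ℝ) : ℝ := ∑' n : ℤ, (n : ℝ) * p n

/-- Variance `Var(p) = ∑_n (n − μ_p)²·p(n)` of a distribution on `ℤ`. -/
noncomputable def variance (p : ℤ → ℝ) : ℝ := ∑' n : ℤ, ((n : ℝ) - mean p) ^ 2 * p n

lemma conv_assoc_aux (p q qt : ℤ → ℝ) (nq : ℤ)
    (hpb : SuppBelow p) (hqb : SuppBelow q) (hqt : IsRecip q qt nq) (n : ℤ) :
    conv (conv p qt) q n = p n := by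
  obtain ⟨A, hA⟩ := hpb
  obtain ⟨B, hB⟩ := hqb
  obtain ⟨-, hC, hD⟩ := hqt
  have hs : Summable (Function.uncurry fun m k : ℤ => p k * qt (m - k) * q (n - m)) := by
    apply summable_of_ne_finset_zero
      (s := Finset.Icc (A - nq) (n - B) ×ˢ Finset.Icc A (n - B + nq))
    rintro ⟨m, k⟩ h
    simp only [Function.uncurry]
    by_cases h1 : k < A
    · simp [hA k h1]
    by_cases h2 : m - k < -nq
    · simp [hC _ h2]
    by_cases h3 : n - m < B
    · simp [hB _ h3]
    exfalso
    apply h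
    simp only [Finset.mem_product, Finset.mem_Icc]
    omega
  have e1 : conv (conv p qt) q n = ∑' m : ℤ, ∑' k : ℤ, p k * qt (m - k) * q (n - m) := by
    unfold conv
    congr 1
    funext m
    rw [tsum_mul_right]
  rw [e1, ← hs.tsum_comm]
  have e2 : ∀ k : ℤ, ∑' m : ℤ, p k * qt (m - k) * q (n - m) = if k = n then p n else 0 := by
    intro k
    have e3 : ∑' m : ℤ, qt (m - k) * q (n - m) = conv qt q (n - k) := by
      unfold conv
      rw [← (Equiv.addRight k).tsum_eq]
      congr 1
      funext m
      simp only [Equiv.coe_addRight, add_sub_cancel_right]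
      congr 2
      ring
    simp_rw [mul_assoc]
    rw [tsum_mul_left, e3, hD]
    by_cases h : k = n
    · simp [h]
    · have : n - k ≠ 0 := by omega
      simp [h, this]
  simp_rw [e2]
  simp

/-- the shear `(n, k) ↦ (k, n - k)` -/
def shearE : ℤ × ℤ ≃ ℤ × ℤ where
  toFun x := (x.2, x.1 - x.2)
  invFun y := (y.1 + y.2, y.1)
  left_inv x := by ext <;> simp
  right_inv y := by ext <;> simp

lemma fiber_summable (w q : ℤ → ℝ) (hwb : SuppBelow w) (hqb : SuppBelow q) (n : ℤ) :
    Summable fun k : ℤ => w k * q (n - k) := by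
  obtain ⟨A, hA⟩ := hwb
  obtain ⟨B, hB⟩ := hqb
  apply summable_of_ne_finset_zero (s := Finset.Icc A (n - B))
  intro k h
  by_cases h1 : k < A
  · simp [hA k h1]
  by_cases h3 : n - k < B
  · simp [hB _ h3]
  exfalso
  apply h
  simp only [Finset.mem_Icc]
  omega

lemma shear_summable (w q p g : ℤ → ℝ) (hwb : SuppBelow w) (hqb : SuppBelow q)
    (hw : ∀ n, 0 ≤ w n) (hq : ∀ n, 0 ≤ q n) (hg : ∀ n, 0 ≤ g n)
    (hc : ∀ n, conv w q n = p n) (hs : Summable fun n => g n * p n) :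
    Summable fun x : ℤ × ℤ => g (x.1 + x.2) * (w x.1 * q x.2) := by
  rw [← shearE.summable_iff]
  rw [summable_prod_of_nonneg]
  · constructor
    · intro n
      simpa [shearE] using (fiber_summable w q hwb hqb n).mul_left (g n)
    · convert hs using 2 with n
      rw [← hc n]
      simp [shearE, tsum_mul_left, conv]
  · intro x
    exact mul_nonneg (hg _) (mul_nonneg (hw _) (hq _))

lemma shear_tsum (w q p g : ℤ → ℝ) (hc : ∀ n, conv w q n = p n)
    (hs : Summable fun x : ℤ × ℤ => g (x.1 + x.2) * (w x.1 * q x.2)) :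
    ∑' n, g n * p n = ∑' x : ℤ × ℤ, g (x.1 + x.2) * (w x.1 * q x.2) := by
  have hs' := (shearE.summable_iff).2 hs
  rw [← shearE.tsum_eq]
  refine Eq.trans ?_ (Summable.tsum_prod hs').symm
  congr 1
  funext n
  rw [← hc n]
  simp [shearE, tsum_mul_left, conv]

lemma conv_suppBelow (p qt : ℤ → ℝ) (N : ℤ) (hpb : SuppBelow p)
    (h : ∀ n : ℤ, n < N → qt n = 0) : SuppBelow (conv p qt) := by
  obtain ⟨A, hA⟩ := hpb
  refine ⟨A + N, fun n hn => ?_⟩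
  unfold conv
  convert tsum_zero with k
  by_cases h1 : k < A
  · simp [hA k h1]
  · rw [h (n - k) (by omega), mul_zero]

lemma summable_mean (w : ℤ → ℝ) (h0 : ∀ n, 0 ≤ w n) (h1 : Summable w)
    (h2 : Summable fun n : ℤ => (n : ℝ) ^ 2 * w n) : Summable fun n : ℤ => (n : ℝ) * w n := by
  refine Summable.of_norm_bounded (h2.add h1) fun n => ?_
  rw [Real.norm_eq_abs, abs_mul, abs_of_nonneg (h0 n)]
  have : |(n : ℝ)| ≤ (n : ℝ) ^ 2 + 1 := by
    rw [← sq_abs]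
    nlinarith [sq_nonneg (|(n : ℝ)| - 1), abs_nonneg (n : ℝ)]
  nlinarith [h0 n]

lemma summable_centered (w : ℤ → ℝ) (c : ℝ) (h1 : Summable w)
    (hm : Summable fun n : ℤ => (n : ℝ) * w n)
    (h2 : Summable fun n : ℤ => (n : ℝ) ^ 2 * w n) :
    Summable fun n : ℤ => ((n : ℝ) - c) ^ 2 * w n := by
  refine ((h2.sub (hm.mul_left (2 * c))).add (h1.mul_left (c ^ 2))).congr fun n => ?_
  ring

lemma prod_mul (f g : ℤ → ℝ) (hf : Summable f) (hg : Summable g) :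
    HasSum (fun x : ℤ × ℤ => f x.1 * g x.2) ((∑' n, f n) * ∑' n, g n) := by
  have hs : Summable fun x : ℤ × ℤ => f x.1 * g x.2 := summable_mul_of_summable_norm hf.norm hg.norm
  exact hf.hasSum.mul hg.hasSum hs

lemma centered_zero (w : ℤ → ℝ) (h1 : HasSum w 1) (hm : Summable fun n : ℤ => (n : ℝ) * w n) :
    HasSum (fun n : ℤ => ((n : ℝ) - mean w) * w n) 0 := by
  have := hm.hasSum.sub (h1.mul_left (mean w))
  unfold mean at *
  simpa [sub_mul] using this

/-- the variance is monotone under a-majorization: if `p, q` are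
supported-below probability distributions with finite second moments and
`p ≻_a q`, then `Var(p) ≥ Var(q)`; moreover `w := p*q̃` is a probability
distribution with `μ_p = μ_w + μ_q` and `Var(p) = Var(w) + Var(q)`. -/
theorem variance_monotone_amaj (p q qt : ℤ → ℝ) (nq : ℤ)
    (hp : IsProbDist p) (hq : IsProbDist q)
    (hpb : SuppBelow p) (hqb : SuppBelow q)
    (hqt : IsRecip q qt nq)
    (hp2 : Summable fun n : ℤ => (n : ℝ) ^ 2 * p n)
    (hq2 : Summable fun n : ℤ => (n : ℝ) ^ 2 * q n)
    (hmaj : ∀ n : ℤ, 0 ≤ conv p qt n) :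
    variance q ≤ variance p ∧
    IsProbDist (conv p qt) ∧
    mean p = mean (conv p qt) + mean q ∧
    variance p = variance (conv p qt) + variance q := by
  have hc := conv_assoc_aux p q qt nq hpb hqb hqt
  have hwb : SuppBelow (conv p qt) := conv_suppBelow p qt (-nq) hpb hqt.2.1
  have hq0 : 0 < q nq := hqt.1.1
  generalize conv p qt = w at *
  obtain ⟨hp0, hp1⟩ := hp
  obtain ⟨hqn, hq1⟩ := hq
  have hF : Summable fun x : ℤ × ℤ => (1 : ℝ) * (w x.1 * q x.2) :=
    shear_summable w q p (fun _ => 1) hwb hqb hmaj hqn (fun _ => zero_le_one) hc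
      (by simpa using hp1.summable)
  have hF2 := shear_summable w q p (fun n => (n : ℝ) ^ 2) hwb hqb hmaj hqn
      (fun _ => sq_nonneg _) hc hp2
  have hinj : Function.Injective fun k : ℤ => (k, nq) := fun a b h => by simpa using h
  have hws : Summable w := by
    have := (hF.comp_injective hinj).mul_right (q nq)⁻¹
    refine this.congr fun k => ?_
    simp only [Function.comp]
    field_simp
  have hwS : Summable fun k : ℤ => (((k + nq : ℤ) : ℝ)) ^ 2 * w k := by
    have := (hF2.comp_injective hinj).mul_right (q nq)⁻¹
    refine this.congr fun k => ?_
    simp only [Function.comp]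
    field_simp
  have hw2 : Summable fun k : ℤ => (k : ℝ) ^ 2 * w k := by
    refine Summable.of_nonneg_of_le (fun k => mul_nonneg (sq_nonneg _) (hmaj k)) (fun k => ?_)
      ((hwS.mul_left 2).add (hws.mul_left (2 * (nq : ℝ) ^ 2)))
    push_cast
    have : (k : ℝ) ^ 2 ≤ 2 * ((k : ℝ) + nq) ^ 2 + 2 * (nq : ℝ) ^ 2 := by
      nlinarith [sq_nonneg ((k : ℝ) + 2 * nq)]
    nlinarith [hmaj k]
  have hw1 : HasSum w 1 := by
    have h := shear_tsum w q p (fun _ => 1) hc hF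
    simp only [one_mul] at h
    rw [hp1.tsum_eq, (prod_mul w q hws hq1.summable).tsum_eq, hq1.tsum_eq, mul_one] at h
    rw [h]
    exact hws.hasSum
  have hwm := summable_mean w hmaj hws hw2
  have hqm := summable_mean q hqn hq1.summable hq2
  have hmean : mean p = mean w + mean q := by
    have H := (prod_mul _ _ hwm hq1.summable).add (prod_mul _ _ hws hqm)
    rw [hq1.tsum_eq, hw1.tsum_eq, mul_one, one_mul] at H
    have H' : HasSum (fun x : ℤ × ℤ => ((x.1 + x.2 : ℤ) : ℝ) * (w x.1 * q x.2))
        (mean w + mean q) := by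
      refine Eq.mpr (congrArg (fun f => HasSum f _) (funext fun x => ?_)) H
      push_cast
      ring
    have := shear_tsum w q p (fun n => (n : ℝ)) hc H'.summable
    rw [H'.tsum_eq] at this
    exact this
  have hwc := centered_zero w hw1 hwm
  have hqc := centered_zero q hq1 hqm
  have hwv := summable_centered w (mean w) hws hwm hw2
  have hqv := summable_centered q (mean q) hq1.summable hqm hq2
  have hvar : variance p = variance w + variance q := by
    have H := ((prod_mul _ _ hwv hq1.summable).add (prod_mul _ _ hws hqv)).add
      ((prod_mul _ _ hwc.summable hqc.summable).mul_left 2)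
    rw [hq1.tsum_eq, hw1.tsum_eq, mul_one, one_mul, hwc.tsum_eq, zero_mul, mul_zero, add_zero] at H
    have H' : HasSum (fun x : ℤ × ℤ => (((x.1 + x.2 : ℤ) : ℝ) - mean p) ^ 2 * (w x.1 * q x.2))
        (variance w + variance q) := by
      refine Eq.mpr (congrArg (fun f => HasSum f _) (funext fun x => ?_)) H
      rw [hmean]
      push_cast
      ring
    have := shear_tsum w q p (fun n => ((n : ℝ) - mean p) ^ 2) hc H'.summable
    rw [H'.tsum_eq] at this
    exact this
  have hvw : 0 ≤ variance w := tsum_nonneg fun n => mul_nonneg (sq_nonneg _) (hmaj n)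
  exact ⟨by linarith, ⟨hmaj, hw1⟩, hmean, hvar⟩
end

section
/- For every R > 0, the energy distribution of many copies of the coherence bit converges in total variation to a shifted Poisson distribution: lim_{m→∞} d_TV( b_{⌈Rm⌉}, Υ_{s_m} P_{Rm/4} ) = 0, where b_N is the symmetric binomial distribution with N trials, s_m := ⌊⌈Rm⌉/4⌋, P_λ is the Poisson distribution with parameter λ (regarded as a function on ℤ vanishing on negative integers), and (Υ_k a)(n) := a(n−k). -/
/-- The symmetric binomial distribution with `N` trials, as a function on `ℤ`:
`b_N(n) = (N choose n)/2^N` for `0 ≤ n ≤ N` and `0` otherwise.  It is the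
energy distribution of `N` copies of the coherence bit `(|0⟩+|1⟩)/√2`. -/
noncomputable def binom (N : ℕ) : ℤ → ℝ := fun n =>
  if 0 ≤ n ∧ n ≤ (N : ℤ) then (N.choose n.toNat : ℝ) / 2 ^ N else 0

/-- Total variation distance `d_TV(f,g) = (1/2)·∑_{n∈ℤ} |f(n) − g(n)|`. -/
noncomputable def dTV (f g : ℤ → ℝ) : ℝ := (1 / 2) * ∑' n : ℤ, |f n - g n|

open Filter Topology

lemma aux_tv (p q : ℤ → ℝ) (hp : ∀ n, 0 ≤ p n) (hq : ∀ n, 0 ≤ q n) (hp1 : HasSum p 1)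
    (hq1 : HasSum q 1) (W : Set ℤ) (ε M : ℝ) (hε : ε < 1)
    (hpW : ∑' n, Wᶜ.indicator p n ≤ ε) (hqW : ∑' n, Wᶜ.indicator q n ≤ ε) (hM : 1 ≤ M)
    (h : ∀ n ∈ W, ∀ m ∈ W, p n * q m ≤ M * (p m * q n)) :
    ∑' n, |p n - q n| ≤ 2 * (ε + (M / (1 - ε) - 1)) := by
  have sp := hp1.summable
  have sq := hq1.summable
  have hε0 : 0 ≤ ε := (tsum_nonneg (fun n => Set.indicator_nonneg (fun n _ => hp n) n)).trans hpW
  have hA : 1 ≤ M / (1 - ε) := by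
    rw [le_div_iff₀ (by linarith)]; linarith
  have hQ : 1 - ε ≤ ∑' n, W.indicator q n := by
    have e : ∑' n, q n = ∑' n, W.indicator q n + ∑' n, Wᶜ.indicator q n := by
      rw [← (sq.indicator W).tsum_add (sq.indicator Wᶜ)]
      congr 1; ext n
      exact (congrFun (Set.indicator_self_add_compl W q) n).symm
    rw [hq1.tsum_eq] at e
    linarith
  have hP : ∑' n, W.indicator p n ≤ 1 := by
    rw [← hp1.tsum_eq]
    exact (sp.indicator W).tsum_le_tsum (fun n => Set.indicator_le_self' (fun _ _ => hp _) n) sp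
  have key : ∀ n ∈ W, p n ≤ M / (1 - ε) * q n := by
    intro n hn
    have h1 : p n * ∑' m, W.indicator q m ≤ M * q n * ∑' m, W.indicator p m := by
      rw [← tsum_mul_left, ← tsum_mul_left]
      refine Summable.tsum_le_tsum (fun m => ?_) ((sq.indicator W).mul_left _)
        ((sp.indicator W).mul_left _)
      by_cases hm : m ∈ W
      · simp only [Set.indicator_of_mem hm]
        have := h n hn m hm
        linarith
      · simp [Set.indicator_of_notMem hm]
    have h2 : p n * (1 - ε) ≤ M * q n := by
      calc p n * (1 - ε) ≤ p n * ∑' m, W.indicator q m :=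
            mul_le_mul_of_nonneg_left hQ (hp n)
        _ ≤ _ := h1
        _ ≤ M * q n * 1 := mul_le_mul_of_nonneg_left hP (mul_nonneg (by linarith) (hq n))
        _ = _ := mul_one _
    rw [div_mul_eq_mul_div, le_div_iff₀ (by linarith)]
    exact h2
  have pt : ∀ n, |p n - q n| ≤
      2 * (Wᶜ.indicator p n + (M / (1 - ε) - 1) * q n) - (p n - q n) := by
    intro n
    have hqn := mul_nonneg (sub_nonneg.2 hA) (hq n)
    by_cases hn : n ∈ W
    · have : n ∉ Wᶜ := fun h => h hn
      rw [Set.indicator_of_notMem this]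
      have := key n hn
      rw [abs_le]
      constructor <;> nlinarith
    · rw [Set.indicator_of_mem (show n ∈ Wᶜ from hn)]
      have := hp n
      have := hq n
      rw [abs_le]
      constructor <;> linarith
  have hs : HasSum (fun n => 2 * (Wᶜ.indicator p n + (M / (1 - ε) - 1) * q n) - (p n - q n))
      (2 * (∑' n, Wᶜ.indicator p n + (M / (1 - ε) - 1) * 1) - (1 - 1)) :=
    ((((sp.indicator Wᶜ).hasSum).add (hq1.mul_left _)).mul_left 2).sub (hp1.sub hq1)
  have := Summable.tsum_le_tsum pt ((sp.sub sq).abs) hs.summable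
  rw [hs.tsum_eq] at this
  linarith

lemma aux_cheb (p : ℤ → ℝ) (hp : ∀ n, 0 ≤ p n) (hp1 : HasSum p 1) (c T V : ℝ) (hT : 0 < T)
    (hV : HasSum (fun n : ℤ => ((n : ℝ) - c) ^ 2 * p n) V) :
    ∑' n, ({n : ℤ | |(n : ℝ) - c| ≤ T}ᶜ).indicator p n ≤ V / T ^ 2 := by
  have h := hV.div_const (T ^ 2)
  rw [← h.tsum_eq]
  refine Summable.tsum_le_tsum (fun n => ?_) (hp1.summable.indicator _) h.summable
  by_cases hn : |(n : ℝ) - c| ≤ T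
  · rw [Set.indicator_of_notMem (by simpa using hn)]
    have := hp n
    positivity
  · rw [Set.indicator_of_mem (by simpa using hn)]
    rw [le_div_iff₀ (by positivity), mul_comm]
    refine mul_le_mul_of_nonneg_right ?_ (hp n)
    rw [← sq_abs ((n : ℝ) - c)]
    push Not at hn
    gcongr

lemma aux_chain (r : ℤ → ℝ) (c T η : ℝ) (hr : ∀ n : ℤ, |(n : ℝ) - c| ≤ T → 0 ≤ r n) (hη : 0 ≤ η)
    (h : ∀ n : ℤ, |(n : ℝ) - c| ≤ T → |((n + 1 : ℤ) : ℝ) - c| ≤ T →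
      r (n + 1) ≤ (1 + η) * r n ∧ r n ≤ (1 + η) * r (n + 1)) (j : ℕ) :
    ∀ m : ℤ, |(m : ℝ) - c| ≤ T → |((m + j : ℤ) : ℝ) - c| ≤ T →
      r (m + j) ≤ Real.exp (2 * T * η) * r m ∧ r m ≤ Real.exp (2 * T * η) * r (m + j) := by
  have key : ∀ m : ℤ, |(m : ℝ) - c| ≤ T → |((m + j : ℤ) : ℝ) - c| ≤ T →
      r (m + j) ≤ (1 + η) ^ j * r m ∧ r m ≤ (1 + η) ^ j * r (m + j) := by
    induction j with
    | zero => intro m _ _; simp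
    | succ j ih =>
      intro m hm hmj
      have hmid : |((m + j : ℤ) : ℝ) - c| ≤ T := by
        rw [abs_le] at *
        push_cast at *
        have : (0 : ℝ) ≤ j := by positivity
        constructor <;> linarith
      obtain ⟨h1, h2⟩ := ih m hm hmid
      have e : m + ((j + 1 : ℕ) : ℤ) = m + j + 1 := by push_cast; ring
      rw [e] at hmj ⊢
      obtain ⟨h3, h4⟩ := h (m + j) hmid hmj
      have hc : (0 : ℝ) ≤ (1 + η) ^ j := by positivity
      constructor
      · calc r (m + j + 1) ≤ (1 + η) * r (m + j) := h3
          _ ≤ (1 + η) * ((1 + η) ^ j * r m) := by gcongr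
          _ = _ := by ring
      · calc r m ≤ (1 + η) ^ j * r (m + j) := h2
          _ ≤ (1 + η) ^ j * ((1 + η) * r (m + j + 1)) := by gcongr
          _ = _ := by ring
  intro m hm hmj
  have hb : (1 + η) ^ j ≤ Real.exp (2 * T * η) := by
    calc (1 + η) ^ j ≤ (Real.exp η) ^ j := by
          gcongr
          linarith [Real.add_one_le_exp η]
      _ = Real.exp (j * η) := by rw [Real.exp_nat_mul]
      _ ≤ _ := by
        gcongr
        rw [abs_le] at hm hmj
        push_cast at hmj
        linarith
  obtain ⟨h1, h2⟩ := key m hm hmj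
  exact ⟨h1.trans (mul_le_mul_of_nonneg_right hb (hr _ hm)),
    h2.trans (mul_le_mul_of_nonneg_right hb (hr _ hmj))⟩

lemma poisson_nonneg {l : ℝ} (hl : 0 ≤ l) (n : ℤ) : 0 ≤ poisson l n := by
  unfold poisson
  split_ifs <;> positivity

lemma poisson_pos {l : ℝ} (hl : 0 < l) (n : ℤ) (hn : 0 ≤ n) : 0 < poisson l n := by
  unfold poisson
  rw [if_pos hn]; positivity

lemma poisson_succ (l : ℝ) (n : ℤ) : ((n : ℝ) + 1) * poisson l (n + 1) = l * poisson l n := by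
  rcases lt_trichotomy n (-1) with h | h | h
  · unfold poisson
    rw [if_neg (by omega), if_neg (by omega)]; simp
  · subst h
    unfold poisson
    simp
  · lift n to ℕ using by omega
    unfold poisson
    rw [if_pos (by omega), if_pos (by omega)]
    have : ((n : ℤ) + 1).toNat = n + 1 := by omega
    rw [this]
    simp only [Int.toNat_natCast, Nat.factorial_succ]
    push_cast
    field_simp
    ring

lemma poisson_sum (l : ℝ) : HasSum (poisson l) 1 := by
  have h : HasSum (fun n : ℕ => poisson l n) 1 := by
    have h0 := (NormedSpace.expSeries_div_hasSum_exp (l : ℝ)).mul_left (Real.exp (-l))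
    rw [← Real.exp_eq_exp_ℝ, ← Real.exp_add] at h0
    simp only [neg_add_cancel, Real.exp_zero] at h0
    convert! h0 using 1
    ext n
    simp [poisson, mul_div_assoc]
  have h2 : HasSum (fun n : ℕ => poisson l (-(n + 1 : ℤ))) 0 := by
    convert! hasSum_zero using 1
  simpa using h.of_nat_of_neg_add_one h2

lemma hasSum_shift {f : ℤ → ℝ} {a : ℝ} (h : HasSum f a) (k : ℤ) :
    HasSum (fun n => f (n - k)) a :=
  (Equiv.subRight k).hasSum_iff.2 h

lemma poisson_mean (l : ℝ) : HasSum (fun n : ℤ => (n : ℝ) * poisson l n) l := by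
  have := hasSum_shift ((poisson_sum l).mul_left l) 1
  rw [mul_one] at this
  convert! this using 1
  ext n
  rw [← poisson_succ]; push_cast; simp

lemma poisson_sq (l : ℝ) : HasSum (fun n : ℤ => (n : ℝ) ^ 2 * poisson l n) (l * (l + 1)) := by
  have := hasSum_shift (((poisson_mean l).add (poisson_sum l)).mul_left l) 1
  convert! this using 1
  ext n
  have := poisson_succ l (n - 1)
  push_cast at this
  simp only [sub_add_cancel] at this
  push_cast
  linear_combination (n : ℝ) * this

lemma poisson_var (l : ℝ) (s : ℤ) : HasSum (fun n : ℤ => ((n : ℝ) - 2 * l) ^ 2 * poisson l (n - s))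
    (l + (s - l) ^ 2) := by
  have := hasSum_shift (((poisson_sq l).add ((poisson_mean l).mul_left (2 * (s - 2 * l)))).add
    ((poisson_sum l).mul_left ((s - 2 * l) ^ 2))) s
  convert! this using 1
  · ext n; push_cast; ring
  · ring

lemma binom_nonneg (N : ℕ) (n : ℤ) : 0 ≤ binom N n := by
  unfold binom
  split_ifs <;> positivity

lemma binom_pos (N : ℕ) (n : ℤ) (h : 0 ≤ n) (h' : n ≤ N) : 0 < binom N n := by
  unfold binom
  rw [if_pos ⟨h, h'⟩]
  have : 0 < N.choose n.toNat := Nat.choose_pos (by omega)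
  positivity

lemma binom_nat (N k : ℕ) : binom N k = (N.choose k : ℝ) / 2 ^ N := by
  unfold binom
  split_ifs with h
  · simp
  · rw [Nat.choose_eq_zero_of_lt (by omega)]; simp

lemma binom_neg (N : ℕ) (n : ℤ) (h : n < 0) : binom N n = 0 := by
  unfold binom
  rw [if_neg (by omega)]

lemma binom_rec (N : ℕ) (n : ℤ) : binom (N + 1) n = (binom N n + binom N (n - 1)) / 2 := by
  rcases lt_trichotomy n 0 with h | h | h
  · simp [binom_neg _ _ h, binom_neg _ (n - 1) (by omega)]
  · subst h
    rw [binom_neg N (0 - 1) (by omega)]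
    have := binom_nat N 0
    have h2 := binom_nat (N + 1) 0
    simp only [Nat.cast_zero] at this h2
    rw [this, h2]
    simp only [Nat.choose_zero_right, pow_succ]
    field_simp
    norm_num
  · obtain ⟨k, rfl⟩ : ∃ k : ℕ, n = k + 1 := ⟨(n - 1).toNat, by omega⟩
    have h1 : (k : ℤ) + 1 = ((k + 1 : ℕ) : ℤ) := by push_cast; ring
    have h2 : (k : ℤ) + 1 - 1 = ((k : ℕ) : ℤ) := by ring
    rw [h2, h1]
    simp only [binom_nat, Nat.choose_succ_succ]
    push_cast
    field_simp
    ring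

lemma binom_succ (N : ℕ) (n : ℤ) (hn : 0 ≤ n) (hN : n ≤ N) :
    ((n : ℝ) + 1) * binom N (n + 1) = (N - n) * binom N n := by
  lift n to ℕ using hn
  have h1 : (n : ℤ) + 1 = ((n + 1 : ℕ) : ℤ) := by push_cast; ring
  rw [h1, binom_nat, binom_nat]
  have := Nat.choose_succ_right_eq N n
  have h2 : ((N.choose (n + 1) : ℕ) : ℝ) * (n + 1) = N.choose n * (N - n) := by
    rw [← Nat.cast_sub (by omega)]
    exact_mod_cast this
  push_cast
  rw [← mul_div_assoc, ← mul_div_assoc, mul_comm, h2, mul_comm]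

lemma binom_sum (N : ℕ) : HasSum (binom N) 1 ∧
    HasSum (fun n : ℤ => (2 * (n : ℝ) - N) ^ 2 * binom N n) (N : ℝ) := by
  induction N with
  | zero =>
    have h0 : ∀ n : ℤ, n ≠ 0 → binom 0 n = 0 := by
      intro n hn
      unfold binom
      rw [if_neg (by push_cast; omega)]
    constructor
    · convert! hasSum_single (0 : ℤ) h0 using 1
      have := binom_nat 0 0
      simp at this
      exact this.symm
    · convert! hasSum_zero using 1
      · ext n
        by_cases hn : n = 0
        · subst hn; simp
        · rw [h0 n hn, mul_zero]
      · simp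
  | succ N ih =>
    obtain ⟨h1, h2⟩ := ih
    constructor
    · convert! (h1.add (hasSum_shift h1 1)).div_const 2 using 1
      · ext n; exact binom_rec N n
      · norm_num
    · have s0 := h1
      -- centered second moments of the two halves
      have hs : HasSum (fun n : ℤ => (2 * (n : ℝ) - (N + 1)) ^ 2 * binom N n
          + (2 * (n : ℝ) - (N + 1) + 2) ^ 2 * binom N n) (2 * (N : ℝ) + 2 * 1) := by
        convert! (h2.mul_left 2).add (h1.mul_left 2) using 1
        ext n; ring
      have sA : Summable (fun n : ℤ => (2 * (n : ℝ) - (N + 1)) ^ 2 * binom N n) := by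
        refine Summable.of_nonneg_of_le (fun n => mul_nonneg (sq_nonneg _) (binom_nonneg _ _))
          (fun n => ?_) hs.summable
        have := mul_nonneg (sq_nonneg (2 * (n : ℝ) - (N + 1) + 2)) (binom_nonneg N n)
        linarith
      have sB : Summable (fun n : ℤ => (2 * (n : ℝ) - (N + 1) + 2) ^ 2 * binom N n) := by
        refine Summable.of_nonneg_of_le (fun n => mul_nonneg (sq_nonneg _) (binom_nonneg _ _))
          (fun n => ?_) hs.summable
        have := mul_nonneg (sq_nonneg (2 * (n : ℝ) - (N + 1))) (binom_nonneg N n)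
        linarith
      have e := (sA.hasSum.add sB.hasSum).unique hs
      have t := (sA.hasSum.add (hasSum_shift sB.hasSum 1)).div_const 2
      rw [e] at t
      convert! t using 1
      · ext n
        rw [binom_rec]; push_cast; ring
      · push_cast; ring

lemma binom_cheb (N : ℕ) (c T : ℝ) (hT : 0 < T) (hc : |(N : ℝ) / 2 - c| ≤ 1 / 2) :
    ∑' n, ({n : ℤ | |(n : ℝ) - c| ≤ T}ᶜ).indicator (binom N) n ≤ (N / 2 + 1 / 2) / T ^ 2 := by
  obtain ⟨h1, h2⟩ := binom_sum N
  have hs := (h2.div_const 2).add (h1.mul_left (1 / 2))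
  have hle : ∀ n : ℤ, ((n : ℝ) - c) ^ 2 * binom N n ≤
      (2 * (n : ℝ) - N) ^ 2 * binom N n / 2 + 1 / 2 * binom N n := by
    intro n
    have hb := binom_nonneg N n
    have hsq : ((N : ℝ) / 2 - c) ^ 2 ≤ 1 / 4 := by
      rw [← sq_abs]
      nlinarith [abs_nonneg ((N : ℝ) / 2 - c)]
    have : ((n : ℝ) - c) ^ 2 ≤ (2 * (n : ℝ) - N) ^ 2 / 2 + 1 / 2 := by
      nlinarith [sq_nonneg (((n : ℝ) - N / 2) - (N / 2 - c))]
    nlinarith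
  have sm : Summable (fun n : ℤ => ((n : ℝ) - c) ^ 2 * binom N n) :=
    Summable.of_nonneg_of_le (fun n => mul_nonneg (sq_nonneg _) (binom_nonneg _ _)) hle hs.summable
  refine (aux_cheb _ (binom_nonneg N) h1 c T _ hT sm.hasSum).trans ?_
  gcongr
  have := sm.tsum_le_tsum hle hs.summable
  rw [hs.tsum_eq] at this
  linarith

lemma ratio_arith (l T x a b : ℝ) (hT : T ≤ l / 4) (hT1 : 1 ≤ T) (hx : |x| ≤ T)
    (ha : 0 ≤ a) (ha' : a ≤ 1) (hb : 0 ≤ b) (hb' : b ≤ 2) :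
    (2 * l - x + a) * (l + x + b) ≤ (1 + 2 * (T ^ 2 + 9 * l) / l ^ 2) * (l * (2 * l + x + 1)) ∧
    l * (2 * l + x + 1) ≤ (1 + 2 * (T ^ 2 + 9 * l) / l ^ 2) * ((2 * l - x + a) * (l + x + b)) := by
  rw [abs_le] at hx
  obtain ⟨h1, h2⟩ := hx
  have hl : 4 ≤ l := by linarith
  have hx2 : x ^ 2 ≤ T ^ 2 := by nlinarith
  have hab : a * b ≤ 2 := by nlinarith
  have hab0 : 0 ≤ a * b := by positivity
  have hax : |(a - b) * x| ≤ 2 * T := by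
    rw [abs_mul]
    exact mul_le_mul (abs_le.2 ⟨by linarith, by linarith⟩) (abs_le.2 ⟨h1, h2⟩) (abs_nonneg _)
      (by norm_num)
  rw [abs_le] at hax
  have hla : l * a ≤ l := by nlinarith
  have hla0 : 0 ≤ l * a := by positivity
  have hlb : l * b ≤ 2 * l := by nlinarith
  have hlb0 : 0 ≤ l * b := by positivity
  have hd : (2 * l - x + a) * (l + x + b) - l * (2 * l + x + 1) =
      - x ^ 2 + l * a + (a - b) * x + a * b + 2 * (l * b) - l := by ring
  have hη : 0 ≤ 2 * (T ^ 2 + 9 * l) / l ^ 2 := by positivity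
  have hA : l ^ 2 / 2 ≤ l * (2 * l + x + 1) := by nlinarith
  have hB : l ^ 2 / 2 ≤ (2 * l - x + a) * (l + x + b) := by
    have : l * (l / 2) ≤ (2 * l - x + a) * (l + x + b) := by
      apply mul_le_mul <;> linarith
    linarith
  have hmul : 2 * (T ^ 2 + 9 * l) / l ^ 2 * (l ^ 2 / 2) = T ^ 2 + 9 * l := by
    field_simp
  have hA' := mul_le_mul_of_nonneg_left hA hη
  have hB' := mul_le_mul_of_nonneg_left hB hη
  rw [hmul] at hA' hB'
  constructor
  · nlinarith
  · nlinarith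

lemma main_bound (l T : ℝ) (N : ℕ) (s : ℤ) (hT : T ≤ l / 4) (hT1 : 1 ≤ T)
    (hN : 4 * l ≤ N) (hN' : (N : ℝ) ≤ 4 * l + 1) (hs : l - 1 ≤ s) (hs' : (s : ℝ) ≤ l + 1)
    (hε : 4 * l / T ^ 2 < 1) :
    dTV (binom N) (fun n => poisson l (n - s)) ≤ 4 * l / T ^ 2 +
      (Real.exp (2 * T * (2 * (T ^ 2 + 9 * l) / l ^ 2)) / (1 - 4 * l / T ^ 2) - 1) := by
  have hl : 4 ≤ l := by linarith
  have hq0 : ∀ n : ℤ, 0 ≤ poisson l (n - s) := fun n => poisson_nonneg (by linarith) _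
  have hη : 0 ≤ 2 * (T ^ 2 + 9 * l) / l ^ 2 := by positivity
  -- positivity on the window
  have hw : ∀ n : ℤ, |(n : ℝ) - 2 * l| ≤ T → 0 ≤ n ∧ n ≤ N ∧ 0 ≤ n - s := by
    intro n hn
    rw [abs_le] at hn
    refine ⟨?_, ?_, ?_⟩
    · have : (0 : ℝ) ≤ n := by linarith
      exact_mod_cast this
    · have : (n : ℝ) ≤ N := by linarith
      exact_mod_cast this
    · have : (0 : ℝ) ≤ ((n - s : ℤ) : ℝ) := by push_cast; linarith
      exact_mod_cast this
  have hbp : ∀ n : ℤ, |(n : ℝ) - 2 * l| ≤ T → 0 < binom N n := fun n hn =>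
    binom_pos _ _ (hw n hn).1 (hw n hn).2.1
  have hqp : ∀ n : ℤ, |(n : ℝ) - 2 * l| ≤ T → 0 < poisson l (n - s) := fun n hn =>
    poisson_pos (by linarith) _ (hw n hn).2.2
  have step : ∀ n : ℤ, |(n : ℝ) - 2 * l| ≤ T → |((n + 1 : ℤ) : ℝ) - 2 * l| ≤ T →
      binom N (n + 1) / poisson l (n + 1 - s) ≤
        (1 + 2 * (T ^ 2 + 9 * l) / l ^ 2) * (binom N n / poisson l (n - s)) ∧
      binom N n / poisson l (n - s) ≤
        (1 + 2 * (T ^ 2 + 9 * l) / l ^ 2) * (binom N (n + 1) / poisson l (n + 1 - s)) := by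
    intro n hn hn1
    obtain ⟨r1, r2⟩ := ratio_arith l T (n - 2 * l) (N - 4 * l) (l + 1 - s) hT hT1 hn
      (by linarith) (by linarith) (by linarith) (by linarith)
    have eb := binom_succ N n (hw n hn).1 (hw n hn).2.1
    have eq := poisson_succ l (n - s)
    rw [show n - s + 1 = n + 1 - s by ring] at eq
    push_cast at eq
    have p1 := hbp n hn
    have p2 := hbp _ hn1
    have p3 := hqp n hn
    have p4 := hqp _ hn1
    rw [abs_le] at hn
    have d1 : (0 : ℝ) < n + 1 := by linarith
    have d2 : (0 : ℝ) < n - s + 1 := by linarith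
    have d3 : (0 : ℝ) < l := by linarith
    have e1 : binom N (n + 1) = (N - n) * binom N n / (n + 1) := by
      rw [eq_div_iff d1.ne']; linarith
    have e2 : poisson l (n + 1 - s) = l * poisson l (n - s) / (n - s + 1) := by
      rw [eq_div_iff d2.ne']; linarith
    have e3 : binom N (n + 1) / poisson l (n + 1 - s) =
        ((N - n) * (n - s + 1)) / (l * (n + 1)) * (binom N n / poisson l (n - s)) := by
      rw [e1, e2]; field_simp
    rw [e3]
    have hr : 0 < binom N n / poisson l (n - s) := by positivity
    have hden : 0 < l * ((n : ℝ) + 1) := by positivity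
    have q1 : 2 * l - (n - 2 * l) + (N - 4 * l) = (N - n : ℝ) := by ring
    have q2 : l + (n - 2 * l) + (l + 1 - s) = (n - s + 1 : ℝ) := by ring
    have q3 : 2 * l + (n - 2 * l) + 1 = (n + 1 : ℝ) := by ring
    rw [q1, q2, q3] at r1 r2
    constructor
    · refine mul_le_mul_of_nonneg_right ?_ hr.le
      rwa [div_le_iff₀ hden]
    · rw [← mul_assoc]
      refine le_mul_of_one_le_left hr.le ?_
      rw [← mul_div_assoc, le_div_iff₀ hden, one_mul]
      exact r2
  have chain := aux_chain (fun n => binom N n / poisson l (n - s)) (2 * l) T _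
    (fun n hn => div_nonneg (hbp n hn).le (hqp n hn).le) hη step
  have hpair : ∀ n ∈ {n : ℤ | |(n : ℝ) - 2 * l| ≤ T}, ∀ m ∈ {n : ℤ | |(n : ℝ) - 2 * l| ≤ T},
      binom N n * poisson l (m - s) ≤ Real.exp (2 * T * (2 * (T ^ 2 + 9 * l) / l ^ 2)) *
        (binom N m * poisson l (n - s)) := by
    intro n hn m hm
    have : binom N n / poisson l (n - s) ≤ Real.exp (2 * T * (2 * (T ^ 2 + 9 * l) / l ^ 2)) *
        (binom N m / poisson l (m - s)) := by
      rcases le_total n m with h | h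
      · obtain ⟨j, rfl⟩ := Int.le.dest h
        exact (chain j n hn hm).2
      · obtain ⟨j, rfl⟩ := Int.le.dest h
        exact (chain j m hm hn).1
    have p3 := hqp n hn
    have p4 := hqp m hm
    rw [← mul_div_assoc, div_le_div_iff₀ p3 p4] at this
    linarith
  have hb1 : ∑' n, ({n : ℤ | |(n : ℝ) - 2 * l| ≤ T}ᶜ).indicator (binom N) n ≤ 4 * l / T ^ 2 := by
    refine (binom_cheb N (2 * l) T (by linarith) ?_).trans ?_
    · rw [abs_le]; constructor <;> linarith
    · gcongr; linarith
  have hb2 : ∑' n, ({n : ℤ | |(n : ℝ) - 2 * l| ≤ T}ᶜ).indicator (fun n => poisson l (n - s)) n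
      ≤ 4 * l / T ^ 2 := by
    refine (aux_cheb _ hq0 (hasSum_shift (poisson_sum l) s) (2 * l) T _ (by linarith)
      (poisson_var l s)).trans ?_
    gcongr
    nlinarith
  have := aux_tv (binom N) (fun n => poisson l (n - s)) (binom_nonneg N) hq0 (binom_sum N).1
    (hasSum_shift (poisson_sum l) s) {n : ℤ | |(n : ℝ) - 2 * l| ≤ T} _ _ hε hb1 hb2
    (Real.one_le_exp (by positivity)) hpair
  unfold dTV
  linarith

lemma bound_lim : Tendsto (fun l : ℝ => 4 * l / (l ^ (3 / 5 : ℝ)) ^ 2 +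
      (Real.exp (2 * l ^ (3 / 5 : ℝ) * (2 * ((l ^ (3 / 5 : ℝ)) ^ 2 + 9 * l) / l ^ 2)) /
        (1 - 4 * l / (l ^ (3 / 5 : ℝ)) ^ 2) - 1)) atTop (𝓝 0) ∧
    Tendsto (fun l : ℝ => 4 * l / (l ^ (3 / 5 : ℝ)) ^ 2) atTop (𝓝 0) ∧
    Tendsto (fun l : ℝ => l ^ (3 / 5 : ℝ) / l) atTop (𝓝 0) := by
  have t1 : Tendsto (fun l : ℝ => l ^ (-(1 / 5) : ℝ)) atTop (𝓝 0) :=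
    tendsto_rpow_neg_atTop (by norm_num)
  have t2 : Tendsto (fun l : ℝ => l ^ (-(2 / 5) : ℝ)) atTop (𝓝 0) :=
    tendsto_rpow_neg_atTop (by norm_num)
  have hp : ∀ l : ℝ, 0 < l → (l ^ (3 / 5 : ℝ)) ^ 2 = l ^ (6 / 5 : ℝ) := by
    intro l hl
    rw [← Real.rpow_natCast, ← Real.rpow_mul hl.le]; norm_num
  have A : Tendsto (fun l : ℝ => 4 * l / (l ^ (3 / 5 : ℝ)) ^ 2) atTop (𝓝 0) := by
    have := t1.const_mul 4
    rw [mul_zero] at this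
    refine this.congr' ?_
    filter_upwards [eventually_gt_atTop 0] with l hl
    rw [hp l hl, mul_div_assoc]
    congr 1
    nth_rewrite 2 [← Real.rpow_one l]
    rw [← Real.rpow_sub hl]; norm_num
  have B : Tendsto (fun l : ℝ => l ^ (3 / 5 : ℝ) / l) atTop (𝓝 0) := by
    refine t2.congr' ?_
    filter_upwards [eventually_gt_atTop 0] with l hl
    nth_rewrite 3 [← Real.rpow_one l]
    rw [← Real.rpow_sub hl]; norm_num
  have C : Tendsto (fun l : ℝ =>
      2 * l ^ (3 / 5 : ℝ) * (2 * ((l ^ (3 / 5 : ℝ)) ^ 2 + 9 * l) / l ^ 2)) atTop (𝓝 0) := by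
    have := (t1.const_mul 4).add (B.const_mul 36)
    simp only [mul_zero, add_zero] at this
    refine this.congr' ?_
    filter_upwards [eventually_gt_atTop 0] with l hl
    have e : l ^ (-(1 / 5) : ℝ) = (l ^ (3 / 5 : ℝ)) ^ 3 / l ^ 2 := by
      rw [← Real.rpow_natCast, ← Real.rpow_mul hl.le, ← Real.rpow_natCast l 2, ← Real.rpow_sub hl]
      norm_num
    rw [e]
    field_simp
    ring
  refine ⟨?_, A, B⟩
  have D := (Real.continuous_exp.tendsto 0).comp C
  have E : Tendsto (fun l : ℝ => 1 - 4 * l / (l ^ (3 / 5 : ℝ)) ^ 2) atTop (𝓝 (1 - 0)) :=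
    tendsto_const_nhds.sub A
  have F := A.add ((D.div E (by norm_num)).sub (tendsto_const_nhds (x := (1 : ℝ))))
  simpa using F

/-- for every `R > 0`, the energy distribution of `⌈Rm⌉` copies
of the coherence bit converges in total variation to the shifted Poisson
distribution `Υ_{s_m} P_{Rm/4}` with `s_m = ⌊⌈Rm⌉/4⌋`, as `m → ∞`. -/
theorem binom_to_shifted_poisson (R : ℝ) (hR : 0 < R) :
    Filter.Tendsto
      (fun m : ℕ =>
        dTV (binom ⌈R * (m : ℝ)⌉₊)
          (fun n : ℤ => poisson (R * (m : ℝ) / 4)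
            (n - ⌊((⌈R * (m : ℝ)⌉₊ : ℕ) : ℝ) / 4⌋)))
      Filter.atTop (nhds 0) := by
  have hl : Tendsto (fun m : ℕ => R * (m : ℝ) / 4) atTop atTop :=
    (tendsto_natCast_atTop_atTop.const_mul_atTop hR).atTop_div_const (by norm_num)
  obtain ⟨h1, h2, h3⟩ := bound_lim
  refine squeeze_zero' (Eventually.of_forall fun m => ?_) ?_ (h1.comp hl)
  · unfold dTV
    exact mul_nonneg (by norm_num) (tsum_nonneg fun n => abs_nonneg _)
  · filter_upwards [hl.eventually (h2.eventually_lt_const one_pos),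
      hl.eventually (h3.eventually_lt_const (show (0 : ℝ) < 1 / 4 by norm_num)),
      hl.eventually (eventually_ge_atTop 1)] with m g2 g3 g1
    have c1 := Nat.le_ceil (R * (m : ℝ))
    have c2 := Nat.ceil_lt_add_one (show 0 ≤ R * (m : ℝ) by positivity)
    have c3 := Int.floor_le (((⌈R * (m : ℝ)⌉₊ : ℕ) : ℝ) / 4)
    have c4 := Int.lt_floor_add_one (((⌈R * (m : ℝ)⌉₊ : ℕ) : ℝ) / 4)
    refine main_bound (R * (m : ℝ) / 4) ((R * (m : ℝ) / 4) ^ (3 / 5 : ℝ)) _ _ ?_ ?_ ?_ ?_ ?_ ?_ g2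
    · rw [div_lt_iff₀ (by linarith)] at g3
      linarith
    · exact Real.one_le_rpow g1 (by norm_num)
    all_goals linarith
end
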